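/- Let R be a commutative Noetherian ring and I an ideal of R containing a nonzerodivisor of R. Then tr_R(I) = I·(R : I), and the following are equivalent: (a) I is a trace ideal; (b) I = I·(R : I); (c) I : I = R : I. -/

import Mathlib

/-- The trace ideal of an `R`-module `M`: the sum of the images of all
`R`-linear maps `M → R`. -/
def traceIdeal (R : Type*) [CommRing R] (M : Type*) [AddCommGroup M] [Module R M] : Ideal R :=
  ⨆ f : M →ₗ[R] R, LinearMap.range f

/-- The image of an ideal of `R` in the total ring of fractions `Q(R)`,
as an `R`-submodule of `Q(R)`. -/
noncomputable def idealImage {R : Type*} [CommRing R] (I : Ideal R) :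
    Submodule R (FractionRing R) :=
  Submodule.map (Algebra.linearMap R (FractionRing R)) I

open nonZeroDivisors

section TraceIdeal

variable {R : Type*} [CommRing R]

theorem apply_mem_traceIdeal {M : Type*} [AddCommGroup M] [Module R M] (f : M →ₗ[R] R) (m : M) :
    f m ∈ traceIdeal R M :=
  le_iSup (fun g : M →ₗ[R] R => LinearMap.range g) f ⟨m, rfl⟩

theorem traceIdeal_le_iff {M : Type*} [AddCommGroup M] [Module R M] {J : Ideal R} :
    traceIdeal R M ≤ J ↔ ∀ (f : M →ₗ[R] R) (m : M), f m ∈ J := by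
  refine ⟨fun h f m => h (apply_mem_traceIdeal f m), fun h => iSup_le ?_⟩
  rintro f _ ⟨m, rfl⟩
  exact h f m

/-- The trace of a trace ideal is contained in it. -/
theorem traceIdeal_traceIdeal_le (M : Type*) [AddCommGroup M] [Module R M] :
    traceIdeal R (traceIdeal R M) ≤ traceIdeal R M := by
  rw [traceIdeal_le_iff]
  intro f
  have key : traceIdeal R M ≤
      Submodule.map (traceIdeal R M).subtype (Submodule.comap f (traceIdeal R M)) :=
    traceIdeal_le_iff.2 fun g m => ⟨⟨g m, apply_mem_traceIdeal g m⟩,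
      apply_mem_traceIdeal (f ∘ₗ g.codRestrict (traceIdeal R M) (apply_mem_traceIdeal g)) m, rfl⟩
  intro a
  obtain ⟨b, hb, hba⟩ := key a.2
  rwa [← Subtype.ext hba]

theorem algebraMap_mem_idealImage {I : Ideal R} {a : R} (ha : a ∈ I) :
    algebraMap R (FractionRing R) a ∈ idealImage I :=
  ⟨a, ha, rfl⟩

theorem idealImage_injective :
    Function.Injective (idealImage : Ideal R → Submodule R (FractionRing R)) :=
  Submodule.map_injective_of_injective (IsFractionRing.injective R (FractionRing R))

theorem idealImage_le_one (I : Ideal R) : idealImage I ≤ 1 := by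
  rintro _ ⟨a, -, rfl⟩
  exact Submodule.algebraMap_mem a

theorem idealImage_le_mul_one_div (I : Ideal R) :
    idealImage I ≤ idealImage I * (1 / idealImage I) := by
  intro y hy
  have h : (1 : FractionRing R) ∈ 1 / idealImage I :=
    Submodule.mem_div_iff_forall_mul_mem.2 fun z hz => by
      simpa using idealImage_le_one I hz
  simpa using Submodule.mul_mem_mul hy h

/-- A linear form on an ideal containing a nonzerodivisor is multiplication by a fraction. -/
theorem exists_mem_one_div_idealImage_of_linearMap {I : Ideal R} (hI : ∃ x ∈ I, x ∈ R⁰)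
    (f : I →ₗ[R] R) :
    ∃ α ∈ 1 / idealImage I, ∀ a : I,
      algebraMap R (FractionRing R) (f a) = α * algebraMap R (FractionRing R) a := by
  obtain ⟨x, hx, hx0⟩ := hI
  have hα : ∀ a : I, algebraMap R (FractionRing R) (f a) =
      IsLocalization.mk' (FractionRing R) (f ⟨x, hx⟩) ⟨x, hx0⟩ *
        algebraMap R (FractionRing R) a := by
    intro a
    have h : f a * x = f ⟨x, hx⟩ * a := by
      have h1 : x • a = (a : R) • (⟨x, hx⟩ : I) := Subtype.ext (mul_comm x (a : R))
      have h2 := congrArg f h1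
      rw [map_smul, map_smul, smul_eq_mul, smul_eq_mul] at h2
      rw [mul_comm, h2, mul_comm]
    rw [mul_comm, IsLocalization.mul_mk'_eq_mk'_of_mul, IsLocalization.eq_mk'_iff_mul_eq,
      ← map_mul, h, mul_comm]
  refine ⟨_, Submodule.mem_div_iff_forall_mul_mem.2 ?_, hα⟩
  rintro _ ⟨a, ha, rfl⟩
  rw [Algebra.linearMap_apply, ← hα ⟨a, ha⟩]
  exact Submodule.algebraMap_mem _

/-- Multiplication by an element of `R : I` restricts to a linear form on `I`. -/
theorem exists_linearMap_of_mem_one_div_idealImage {I : Ideal R} {α : FractionRing R}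
    (hα : α ∈ 1 / idealImage I) :
    ∃ f : I →ₗ[R] R, ∀ a : I,
      algebraMap R (FractionRing R) (f a) = α * algebraMap R (FractionRing R) a := by
  have h : ∀ a : I, ∃ r : R,
      algebraMap R (FractionRing R) r = α * algebraMap R (FractionRing R) a := fun a =>
    Submodule.mem_one.1 (Submodule.mem_div_iff_forall_mul_mem.1 hα _
      (algebraMap_mem_idealImage a.2))
  choose f hf using h
  refine ⟨{ toFun := f, map_add' := fun a b => ?_, map_smul' := fun r a => ?_ }, hf⟩
  · apply IsFractionRing.injective R (FractionRing R)
    rw [map_add, hf, hf, hf, Submodule.coe_add, map_add, mul_add]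
  · apply IsFractionRing.injective R (FractionRing R)
    rw [RingHom.id_apply, smul_eq_mul, map_mul, hf, hf, Submodule.coe_smul, smul_eq_mul, map_mul,
      mul_left_comm]

theorem idealImage_traceIdeal {I : Ideal R} (hI : ∃ x ∈ I, x ∈ R⁰) :
    idealImage (traceIdeal R I) = idealImage I * (1 / idealImage I) := by
  apply le_antisymm
  · refine Submodule.map_le_iff_le_comap.2 (traceIdeal_le_iff.2 fun f a => ?_)
    obtain ⟨α, hα, h⟩ := exists_mem_one_div_idealImage_of_linearMap hI f
    rw [Submodule.mem_comap, Algebra.linearMap_apply, h, mul_comm α]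
    exact Submodule.mul_mem_mul (algebraMap_mem_idealImage a.2) hα
  · refine Submodule.mul_le.2 ?_
    rintro _ ⟨a, ha, rfl⟩ α hα
    obtain ⟨f, hf⟩ := exists_linearMap_of_mem_one_div_idealImage hα
    rw [Algebra.linearMap_apply, mul_comm, ← hf ⟨a, ha⟩]
    exact algebraMap_mem_idealImage (apply_mem_traceIdeal f _)

end TraceIdeal

/-- Let `R` be a commutative Noetherian ring and `I` an ideal of `R` containing a
nonzerodivisor of `R`. Then `tr_R(I) = I·(R : I)`, and the following are equivalent:
(a) `I` is a trace ideal; (b) `I = I·(R : I)`; (c) `I : I = R : I`.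
Here, for `R`-submodules `I, J` of `Q(R)`, `I : J = {α ∈ Q(R) | αJ ⊆ I}` is `I / J`,
and an ideal of `R` is identified with its image in `Q(R)`. -/
theorem traceIdeal_eq_mul_colon_and_tfae {R : Type} [CommRing R] [IsNoetherianRing R]
    (I : Ideal R) (hnzd : ∃ x ∈ I, x ∈ nonZeroDivisors R) :
    (idealImage (traceIdeal R ↥I) = idealImage I * (1 / idealImage I)) ∧
    ((∃ (M : Type) (_ : AddCommGroup M) (_ : Module R M),
        Module.Finite R M ∧ I = traceIdeal R M) ↔
      idealImage I = idealImage I * (1 / idealImage I)) ∧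
    ((idealImage I = idealImage I * (1 / idealImage I)) ↔
      idealImage I / idealImage I = 1 / idealImage I) := by
  refine ⟨idealImage_traceIdeal hnzd, ⟨?_, fun h => ?_⟩, fun h => ?_, fun h => ?_⟩
  · rintro ⟨M, _, _, -, rfl⟩
    refine le_antisymm (idealImage_le_mul_one_div _) ?_
    rw [← idealImage_traceIdeal hnzd]
    exact Submodule.map_mono (traceIdeal_traceIdeal_le M)
  · exact ⟨I, inferInstance, inferInstance, inferInstance,
      idealImage_injective (h.trans (idealImage_traceIdeal hnzd).symm)⟩
  · apply le_antisymm
    · intro α hα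
      rw [Submodule.mem_div_iff_forall_mul_mem] at hα ⊢
      exact fun y hy => idealImage_le_one I (hα y hy)
    · intro α hα
      refine Submodule.mem_div_iff_forall_mul_mem.2 fun y hy => ?_
      rw [h, mul_comm α]
      exact Submodule.mul_mem_mul hy hα
  · refine le_antisymm (idealImage_le_mul_one_div I) (Submodule.mul_le.2 fun y hy α hα => ?_)
    rw [← h] at hα
    rw [mul_comm]
    exact Submodule.mem_div_iff_forall_mul_mem.1 hα y hy
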